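/- arXiv:2012.08964 — 3 statements merged into one kernel-verified Lean document; each statement's English description precedes it below -/
import Mathlib

section
/- Quantitative Volume Theorem (Bárány–Katchalski–Pach, with Brazitikos's bound): There is an absolute constant c > 0 such that for every dimension d ≥ 1 the following holds. Let C₁, …, Cₙ be convex sets in ℝ^d (n ≥ 2d) such that the intersection of any 2d of them has Lebesgue measure at least one. Then the intersection ⋂_{i=1}^n Cᵢ has Lebesgue measure at least c^d · d^(−3d/2) · d^(−d). -/
open MeasureTheory

theorem isCompact_convexJoin {E : Type*} [AddCommGroup E] [Module ℝ E] [TopologicalSpace E]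
    [ContinuousAdd E] [ContinuousSMul ℝ E] {s t : Set E} (hs : IsCompact s) (ht : IsCompact t) :
    IsCompact (convexJoin ℝ s t) := by
  have h : convexJoin ℝ s t =
      (fun q : ℝ × E × E => (1 - q.1) • q.2.1 + q.1 • q.2.2) '' (Set.Icc 0 1 ×ˢ s ×ˢ t) := by
    ext x
    simp only [mem_convexJoin, segment_eq_image, Set.mem_image, Set.mem_prod, Prod.exists]
    constructor
    · rintro ⟨a, ha, b, hb, θ, hθ, rfl⟩
      exact ⟨θ, a, b, ⟨hθ, ha, hb⟩, rfl⟩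
    · rintro ⟨θ, a, b, ⟨hθ, ha, hb⟩, rfl⟩
      exact ⟨a, ha, b, hb, θ, hθ, rfl⟩
  rw [h]
  exact (isCompact_Icc.prod (hs.prod ht)).image (by fun_prop)

theorem isCompact_convexHull_iUnion {ι E : Type*} [Finite ι] [AddCommGroup E] [Module ℝ E]
    [TopologicalSpace E] [ContinuousAdd E] [ContinuousSMul ℝ E] {U : ι → Set E}
    (hc : ∀ i, IsCompact (U i)) (hconv : ∀ i, Convex ℝ (U i)) :
    IsCompact (convexHull ℝ (⋃ i, U i)) := by
  classical
  have := Fintype.ofFinite ι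
  suffices h : ∀ s : Finset ι, IsCompact (convexHull ℝ (⋃ i ∈ s, U i)) by
    simpa using h Finset.univ
  intro s
  induction s using Finset.induction_on with
  | empty => simp
  | insert i s _ ih =>
    rw [Finset.set_biUnion_insert]
    rcases (U i).eq_empty_or_nonempty with h | h
    · simpa [h] using ih
    rcases (⋃ j ∈ s, U j).eq_empty_or_nonempty with h' | h'
    · rw [h', Set.union_empty, (hconv i).convexHull_eq]
      exact hc i
    · rw [convexHull_union h h', (hconv i).convexHull_eq]
      exact isCompact_convexJoin (hc i) ih

/-- A compact spanning set contains a basis in which all of its points have coordinates in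
`[-1, 1]`. -/
theorem IsCompact.exists_basis_abs_repr_le_one {E : Type*} [NormedAddCommGroup E]
    [NormedSpace ℝ E] [FiniteDimensional ℝ E] {K : Set E} (hK : IsCompact K)
    (hspan : Submodule.span ℝ K = ⊤) :
    ∃ v : Module.Basis (Fin (Module.finrank ℝ E)) ℝ E,
      (∀ i, v i ∈ K) ∧ ∀ x ∈ K, ∀ i, |v.repr x i| ≤ 1 := by
  classical
  let e := Module.finBasis ℝ E
  obtain ⟨b, hb⟩ : ∃ b : Module.Basis (Fin (Module.finrank ℝ E)) ℝ E, ∀ i, b i ∈ K := by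
    let b := Module.Basis.ofSpan hspan.ge
    have := Module.Finite.finite_basis b
    have := Fintype.ofFinite ((linearIndepOn_empty ℝ (id : E → E)).extend (Set.empty_subset K))
    let e' := Fintype.equivFinOfCardEq (Module.finrank_eq_card_basis b).symm
    refine ⟨b.reindex e', fun i => ?_⟩
    rw [Module.Basis.reindex_apply]
    exact Module.Basis.ofSpan_subset hspan.ge ⟨_, rfl⟩
  have hcont : Continuous fun v : Fin (Module.finrank ℝ E) → E => |e.det v| := by
    refine continuous_abs.comp ?_
    have h : ⇑e.det =
        fun v => (Matrix.of fun i j => e.equivFunL (v j) i).det := by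
      funext v
      rw [Module.Basis.det_apply]
      rfl
    rw [h]
    refine Continuous.matrix_det ?_
    refine continuous_matrix fun i j => ?_
    exact (continuous_apply i).comp (e.equivFunL.continuous.comp (continuous_apply j))
  obtain ⟨v, hv, hmax⟩ := (isCompact_univ_pi fun _ : Fin (Module.finrank ℝ E) => hK).exists_isMaxOn
    ⟨b, fun i _ => hb i⟩ hcont.continuousOn
  have hpos : 0 < |e.det v| :=
    (abs_pos.2 (e.isUnit_det b).ne_zero).trans_le (hmax fun i _ => hb i)
  obtain ⟨hli, hsp⟩ := e.is_basis_iff_det.2 (isUnit_iff_ne_zero.2 (abs_pos.1 hpos))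
  refine ⟨Module.Basis.mk hli hsp.ge, fun i => by simpa using hv i trivial, fun x hx i => ?_⟩
  have h1 := congrArg (fun g => g x) (e.det_smul_mk_coord_eq_det_update hli hsp.ge i)
  have h2 : |e.det (Function.update v i x)| ≤ |e.det v| := by
    refine hmax fun j _ => ?_
    rcases eq_or_ne j i with rfl | h
    · simpa using hx
    · simpa [h] using hv j trivial
  have h3 : e.det v * (Module.Basis.mk hli hsp.ge).repr x i = e.det (Function.update v i x) := by
    simpa using h1
  rw [← h3, abs_mul] at h2
  exact le_of_mul_le_mul_left (by simpa using h2) hpos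

/-- A point at which every functional bounded by `1` on a closed convex set containing `0` is
bounded by `1` belongs to the set. -/
theorem Convex.mem_of_forall_inner_le_one {E : Type*} [NormedAddCommGroup E]
    [InnerProductSpace ℝ E] [CompleteSpace E] {D : Set E} (hconv : Convex ℝ D)
    (hcl : IsClosed D) (h0 : 0 ∈ D) {x : E}
    (hx : ∀ p : E, (∀ y ∈ D, inner ℝ p y ≤ 1) → inner ℝ p x ≤ 1) : x ∈ D := by
  by_contra hxD
  obtain ⟨f, u, hf, hu⟩ := geometric_hahn_banach_closed_point hconv hcl hxD
  have hu0 : 0 < u := by simpa using hf 0 h0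
  have key : ∀ y, inner ℝ (u⁻¹ • (InnerProductSpace.toDual ℝ E).symm f) y = u⁻¹ * f y := by
    intro y
    rw [real_inner_smul_left, InnerProductSpace.toDual_symm_apply]
  have := hx (u⁻¹ • (InnerProductSpace.toDual ℝ E).symm f) fun y hy => by
    rw [key, inv_mul_le_iff₀ hu0]
    linarith [hf y hy]
  rw [key, inv_mul_le_iff₀ hu0] at this
  linarith

/-- A compact convex set with nonempty interior has an interior point about which its asymmetry
is at most `2 d + 1`. -/
theorem Convex.exists_mem_interior_forall_sub_smul_mem {E : Type*} [NormedAddCommGroup E]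
    [NormedSpace ℝ E] [FiniteDimensional ℝ E] {P : Set E} (hconv : Convex ℝ P)
    (hP : IsCompact P) (hint : (interior P).Nonempty) (hd : 0 < Module.finrank ℝ E) :
    ∃ z ∈ interior P, ∀ x ∈ P, z - (2 * (Module.finrank ℝ E : ℝ) + 1)⁻¹ • (x - z) ∈ P := by
  set d := Module.finrank ℝ E with hd'
  have hd0 : (0 : ℝ) < d := by exact_mod_cast hd
  obtain ⟨p, hp⟩ := hint
  let K : Set E := (fun x => p + x) ⁻¹' P
  have hK : IsCompact K := (Homeomorph.addLeft p).isCompact_preimage.2 hP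
  have hKconv : Convex ℝ K := hconv.translate_preimage_right p
  have h0K : (0 : E) ∈ interior K := by
    have : K ∈ nhds (0 : E) := by
      refine (continuous_const.add continuous_id).continuousAt.preimage_mem_nhds ?_
      simpa using mem_interior_iff_mem_nhds.1 hp
    exact mem_interior_iff_mem_nhds.2 this
  have hspan : Submodule.span ℝ K = ⊤ :=
    Submodule.eq_top_of_nonempty_interior' _
      ⟨0, interior_mono Submodule.subset_span h0K⟩
  obtain ⟨v, hv, hrep⟩ := hK.exists_basis_abs_repr_le_one hspan
  have hmem : ∀ a : Fin d → ℝ, (∀ i, 0 ≤ a i) → ∑ i, a i ≤ 1 → p + ∑ i, a i • v i ∈ P := by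
    intro a ha hsum
    have h := hKconv.sum_mem (t := (Finset.univ : Finset (Option (Fin d))))
      (w := fun o => o.elim (1 - ∑ i, a i) a) (z := fun o => o.elim 0 v) ?_ ?_ ?_
    · simpa [K, Fintype.sum_option] using h
    · rintro (_ | i) _
      · simpa using hsum
      · exact ha i
    · simp [Fintype.sum_option]
    · rintro (_ | i) _
      · exact interior_subset h0K
      · exact hv i
  let z := p + ∑ i, (1 / (2 * d : ℝ)) • v i
  have hcoord : ∀ y, p + ∑ i, (1 / (2 * d : ℝ) + v.repr (y - z) i) • v i = y := by
    intro y
    simp_rw [add_smul, Finset.sum_add_distrib, v.sum_repr]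
    simp only [z]
    abel
  refine ⟨z, ?_, fun x hx => ?_⟩
  · rw [mem_interior_iff_mem_nhds]
    have hev : ∀ᶠ y in nhds z, ∀ i, |v.repr (y - z) i| < 1 / (2 * d : ℝ) := by
      rw [Filter.eventually_all]
      intro i
      have hc : Continuous fun y => |v.repr (y - z) i| := by
        have h1 : Continuous fun y => v.equivFunL (y - z) i :=
          (continuous_apply i).comp
            (v.equivFunL.continuous.comp (continuous_id.sub continuous_const))
        exact h1.abs
      exact hc.continuousAt.eventually_lt_const (by simpa using by positivity)
    filter_upwards [hev] with y hy
    rw [← hcoord y]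
    refine hmem _ (fun i => by linarith [abs_lt.1 (hy i)]) ?_
    calc ∑ i, (1 / (2 * d : ℝ) + v.repr (y - z) i) ≤ ∑ _i : Fin d, (1 / (d : ℝ)) := by
          refine Finset.sum_le_sum fun i _ => ?_
          have : 1 / (d : ℝ) = 1 / (2 * d) + 1 / (2 * d) := by field_simp; norm_num
          linarith [abs_lt.1 (hy i)]
      _ = 1 := by simp; field_simp
  · have hx' : ∀ i, |v.repr (x - p) i| ≤ 1 := hrep _ (by simpa [K] using hx)
    have hrepr : ∀ i, v.repr (x - z) i = v.repr (x - p) i - 1 / (2 * d) := by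
      intro i
      have : x - z = (x - p) - ∑ i, (1 / (2 * d : ℝ)) • v i := by simp only [z]; abel
      rw [this, map_sub, Finsupp.sub_apply, v.repr_sum_self]
    rw [← hcoord (z - (2 * (d : ℝ) + 1)⁻¹ • (x - z))]
    have hrepr' : ∀ i, v.repr (z - (2 * (d : ℝ) + 1)⁻¹ • (x - z) - z) i =
        -(2 * (d : ℝ) + 1)⁻¹ * (v.repr (x - p) i - 1 / (2 * d)) := by
      intro i
      rw [← hrepr, sub_sub_cancel_left, ← neg_smul, map_smul, Finsupp.smul_apply, smul_eq_mul]
    simp_rw [hrepr']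
    refine hmem _ (fun i => ?_) ?_
    · have : 1 / (2 * d : ℝ) + -(2 * (d : ℝ) + 1)⁻¹ * (v.repr (x - p) i - 1 / (2 * d)) =
          (2 * (d : ℝ) + 1)⁻¹ * (1 + 1 / d - v.repr (x - p) i) := by
        field_simp
        ring
      rw [this]
      have := (abs_le.1 (hx' i)).2
      have h1 : (0 : ℝ) ≤ 1 / d := by positivity
      exact mul_nonneg (by positivity) (by linarith)
    · calc _ ≤ ∑ _i : Fin d, (1 / (d : ℝ)) := by
            refine Finset.sum_le_sum fun i _ => ?_
            have : 1 / (d : ℝ) - (1 / (2 * d : ℝ) +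
                -(2 * (d : ℝ) + 1)⁻¹ * (v.repr (x - p) i - 1 / (2 * d))) =
                (2 * (d : ℝ) + 1)⁻¹ * (1 + v.repr (x - p) i) := by
              field_simp
              ring
            have h2 : 0 ≤ (2 * (d : ℝ) + 1)⁻¹ * (1 + v.repr (x - p) i) :=
              mul_nonneg (by positivity) (by linarith [(abs_le.1 (hx' i)).1])
            linarith
        _ = 1 := by simp; field_simp

/-- If a finite intersection of closed convex sets is bounded and has asymmetry at most `l` about
a common interior point `0`, then it contains a negative homothetic copy of the intersection of
at most `2 d` of the sets. -/
theorem exists_card_le_forall_neg_smul_mem {ι E : Type*} [Finite ι] [NormedAddCommGroup E]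
    [InnerProductSpace ℝ E] [FiniteDimensional ℝ E] {D : ι → Set E}
    (hconv : ∀ i, Convex ℝ (D i)) (hcl : ∀ i, IsClosed (D i))
    (h0 : ∀ i, (0 : E) ∈ interior (D i)) (hbdd : Bornology.IsBounded (⋂ i, D i))
    (hd : 0 < Module.finrank ℝ E) {l : ℝ} (hl : 0 < l)
    (hasym : ∀ x ∈ ⋂ i, D i, -(l⁻¹ • x) ∈ ⋂ i, D i) :
    ∃ S : Finset ι, S.card ≤ 2 * Module.finrank ℝ E ∧ ∀ x ∈ ⋂ i ∈ S, D i,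
      -(((l + 2) * Module.finrank ℝ E)⁻¹ • x) ∈ ⋂ i, D i := by
  classical
  set d := Module.finrank ℝ E with hd'
  have hd0 : (0 : ℝ) < d := by exact_mod_cast hd
  let U : ι → Set E := fun i => {p | ∀ y ∈ D i, inner ℝ p y ≤ 1}
  have hUconv : ∀ i, Convex ℝ (U i) := by
    intro i p hp q hq a b ha hb hab y hy
    rw [inner_add_left, real_inner_smul_left, real_inner_smul_left]
    nlinarith [mul_le_mul_of_nonneg_left (hp y hy) ha, mul_le_mul_of_nonneg_left (hq y hy) hb]
  have hUcpt : ∀ i, IsCompact (U i) := by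
    intro i
    obtain ⟨r, hr, hball⟩ := Metric.nhds_basis_closedBall.mem_iff.1
      (mem_interior_iff_mem_nhds.1 (h0 i))
    refine Metric.isCompact_of_isClosed_isBounded ?_ ?_
    · have : U i = ⋂ y ∈ D i, {p | inner ℝ p y ≤ 1} := by ext; simp [U]
      rw [this]
      exact isClosed_biInter fun y _ =>
        isClosed_le (continuous_id.inner continuous_const) continuous_const
    · refine (Metric.isBounded_iff_subset_closedBall 0).2 ⟨r⁻¹, fun p hp => ?_⟩
      rw [mem_closedBall_zero_iff]
      rcases eq_or_ne p 0 with rfl | hp0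
      · simpa using hr.le
      have hn : 0 < ‖p‖ := norm_pos_iff.2 hp0
      have := hp ((r / ‖p‖) • p) (hball (by
        rw [mem_closedBall_zero_iff, norm_smul, Real.norm_eq_abs, abs_of_pos (by positivity)]
        field_simp
        rfl))
      rw [real_inner_smul_right, real_inner_self_eq_norm_sq] at this
      rw [le_inv_comm₀ hn hr, ← one_div, le_div_iff₀ hn]
      calc r * ‖p‖ = r / ‖p‖ * ‖p‖ ^ 2 := by field_simp
        _ ≤ 1 := this
  have hmemP : ∀ x : E, (∀ p ∈ ⋃ i, U i, inner ℝ p x ≤ 1) → x ∈ ⋂ i, D i := by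
    intro x hx
    refine Set.mem_iInter.2 fun i => ?_
    exact (hconv i).mem_of_forall_inner_le_one (hcl i) (interior_subset (h0 i))
      fun p hp => hx p (Set.mem_iUnion.2 ⟨i, hp⟩)
  obtain ⟨i₀⟩ : Nonempty ι := by
    by_contra hne
    rw [not_nonempty_iff] at hne
    have : Nontrivial E := Module.nontrivial_of_finrank_pos hd
    simp only [Set.iInter_of_empty] at hbdd
    exact NormedSpace.unbounded_univ ℝ E hbdd
  set Q := convexHull ℝ (⋃ i, U i)
  have hQcpt : IsCompact Q := isCompact_convexHull_iUnion hUcpt hUconv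
  have h0Q : (0 : E) ∈ Q := subset_convexHull ℝ _ (Set.mem_iUnion.2 ⟨i₀, by simp [U]⟩)
  have hmemQ : ∀ p : E, (∀ x ∈ ⋂ i, D i, inner ℝ p x ≤ 1) → p ∈ Q := by
    intro p hp
    refine (convex_convexHull ℝ _).mem_of_forall_inner_le_one hQcpt.isClosed h0Q fun x hx => ?_
    rw [real_inner_comm]
    refine hp x (hmemP x fun q hq => ?_)
    rw [real_inner_comm]
    exact hx q (subset_convexHull ℝ _ hq)
  have h0int : (0 : E) ∈ interior Q := by
    obtain ⟨R, hR, hsub⟩ := hbdd.subset_closedBall_lt 0 0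
    refine mem_interior_iff_mem_nhds.2 (Filter.mem_of_superset
      (Metric.closedBall_mem_nhds 0 (inv_pos.2 hR)) fun p hp => hmemQ p fun x hx => ?_)
    have hx' := mem_closedBall_zero_iff.1 (hsub hx)
    have hp' := mem_closedBall_zero_iff.1 hp
    calc inner ℝ p x ≤ ‖p‖ * ‖x‖ := real_inner_le_norm p x
      _ ≤ R⁻¹ * R := by gcongr
      _ = 1 := by field_simp
  have hspan : Submodule.span ℝ (⋃ i, U i) = ⊤ :=
    Submodule.eq_top_of_nonempty_interior' _
      ⟨0, interior_mono (convexHull_min Submodule.subset_span (Submodule.convex _)) h0int⟩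
  obtain ⟨v, hv, hrep⟩ := (isCompact_iUnion hUcpt).exists_basis_abs_repr_le_one hspan
  let w : E := -∑ i, v i
  have ht₀ : (d * l)⁻¹ • w ∈ Q := by
    refine hmemQ _ fun x hx => ?_
    have hs : ∀ i, -inner ℝ (v i) x ≤ l := by
      intro i
      obtain ⟨j, hj⟩ := Set.mem_iUnion.1 (hv i)
      have := hj _ (Set.mem_iInter.1 (hasym x hx) j)
      rw [inner_neg_right, real_inner_smul_right, ← mul_neg, inv_mul_le_iff₀ hl] at this
      simpa using this
    rw [real_inner_smul_left, inv_mul_le_iff₀ (by positivity), inner_neg_left, sum_inner,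
      ← Finset.sum_neg_distrib]
    calc ∑ i, -inner ℝ (v i) x ≤ ∑ _i : Fin d, l := Finset.sum_le_sum fun i _ => hs i
      _ = d * l * 1 := by simp
  have hw : w ≠ 0 := by
    intro h
    have h1 := congrArg (fun x => v.repr x ⟨0, hd⟩) (neg_eq_zero.1 h)
    have h2 : v.repr (∑ i, (1 : ℝ) • v i) ⟨0, hd⟩ = 1 := by rw [v.repr_sum_self]
    simp only [one_smul] at h2
    rw [h2] at h1
    simp at h1
  obtain ⟨t, ⟨htQ, ht⟩, htmax⟩ : ∃ t : ℝ, (t • w ∈ Q ∧ (d * l)⁻¹ ≤ t) ∧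
      ∀ s : ℝ, s • w ∈ Q → s ≤ t := by
    have hcont : Continuous fun s : ℝ => s • w := continuous_id.smul continuous_const
    have hcpt : IsCompact ((fun s : ℝ => s • w) ⁻¹' Q) := by
      refine Metric.isCompact_of_isClosed_isBounded (hQcpt.isClosed.preimage hcont) ?_
      obtain ⟨R, hsub⟩ := hQcpt.isBounded.subset_closedBall 0
      refine (Metric.isBounded_iff_subset_closedBall 0).2 ⟨R / ‖w‖, fun s hs => ?_⟩
      have := mem_closedBall_zero_iff.1 (hsub hs)
      rw [norm_smul] at this
      rw [mem_closedBall_zero_iff, le_div_iff₀ (norm_pos_iff.2 hw)]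
      exact this
    obtain ⟨t, ht, hmax⟩ := hcpt.exists_isMaxOn ⟨_, ht₀⟩ continuousOn_id
    exact ⟨t, ⟨ht, hmax ht₀⟩, fun s hs => hmax hs⟩
  have htpos : 0 < t := lt_of_lt_of_le (by positivity) ht
  have hyint : t • w ∉ interior Q := by
    intro hmem
    have hcont : Continuous fun s : ℝ => s • w := continuous_id.smul continuous_const
    have hev : ∀ᶠ s in nhds t, s • w ∈ Q :=
      hcont.continuousAt.eventually (mem_interior_iff_mem_nhds.1 hmem)
    obtain ⟨s, hsQ, hs⟩ := ((hev.filter_mono nhdsWithin_le_nhds).and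
      (self_mem_nhdsWithin : Set.Ioi t ∈ nhdsWithin t (Set.Ioi t))).exists
    exact (htmax s hsQ).not_gt hs
  obtain ⟨f, hf⟩ := geometric_hahn_banach_open_point (convex_convexHull ℝ _).interior
    isOpen_interior hyint
  have hfpos : 0 < f (t • w) := by simpa using hf 0 h0int
  have hfle : ∀ q ∈ Q, f q ≤ f (t • w) := by
    intro q hq
    have hq' : q ∈ closure (interior Q) := by
      rw [(convex_convexHull ℝ _).closure_interior_eq_closure_of_nonempty_interior ⟨0, h0int⟩]
      exact subset_closure hq
    exact closure_minimal (fun a ha => (hf a ha).le)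
      (isClosed_le f.continuous continuous_const) hq'
  obtain ⟨κ, _, z, a, hz, haff, ha, hasum, hzsum⟩ := eq_pos_convex_span_of_mem_convexHull htQ
  have hzU : ∀ k, z k ∈ ⋃ i, U i := fun k => hz ⟨k, rfl⟩
  have hfz : ∀ k, f (z k) = f (t • w) := by
    have hle : ∀ k ∈ Finset.univ, a k * f (z k) ≤ a k * f (t • w) := fun k _ =>
      mul_le_mul_of_nonneg_left (hfle _ (subset_convexHull ℝ _ (hzU k))) (ha k).le
    have heq : ∑ k, a k * f (z k) = ∑ k, a k * f (t • w) := by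
      rw [← Finset.sum_mul, hasum, one_mul, ← hzsum, map_sum]
      simp
    intro k
    exact mul_left_cancel₀ (ha k).ne'
      ((Finset.sum_eq_sum_iff_of_le hle).1 heq k (Finset.mem_univ k))
  have hli : LinearIndependent ℝ z := by
    rw [Fintype.linearIndependent_iff]
    intro g hg
    have hg0 : ∑ k, g k = 0 := by
      have : (∑ k, g k) * f (t • w) = 0 := by
        rw [Finset.sum_mul, ← map_zero f, ← hg, map_sum]
        exact Finset.sum_congr rfl fun k _ => by rw [map_smul f (g k), hfz k, smul_eq_mul]
      exact (mul_eq_zero.1 this).resolve_right hfpos.ne'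
    exact fun k => affineIndependent_iff.1 haff Finset.univ g hg0 hg k (Finset.mem_univ k)
  have hcard : Fintype.card κ ≤ d := hli.fintype_card_le_finrank
  choose iv hiv using fun i => Set.mem_iUnion.1 (hv i)
  choose iz hiz using fun k => Set.mem_iUnion.1 (hzU k)
  refine ⟨Finset.univ.image iv ∪ Finset.univ.image iz, ?_, fun x hx => ?_⟩
  · calc _ ≤ (Finset.univ.image iv).card + (Finset.univ.image iz).card := Finset.card_union_le _ _
      _ ≤ d + d := by
        refine add_le_add (Finset.card_image_le.trans ?_) (Finset.card_image_le.trans ?_)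
        · simp [hd']
        · simpa using hcard
      _ = 2 * d := by ring
  · have hx' : ∀ i ∈ Finset.univ.image iv ∪ Finset.univ.image iz, x ∈ D i := by
      simpa only [Set.mem_iInter] using hx
    have hvx : ∀ i, inner ℝ (v i) x ≤ 1 := fun i => hiv i x (hx' _ (by simp))
    have hzx : ∀ k, inner ℝ (z k) x ≤ 1 := fun k => hiz k x (hx' _ (by simp))
    have hwx : inner ℝ (t • w) x ≤ 1 := by
      rw [← hzsum, sum_inner, ← hasum]
      refine Finset.sum_le_sum fun k _ => ?_
      rw [real_inner_smul_left]
      exact mul_le_of_le_one_right (ha k).le (hzx k)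
    have hsum : -∑ i, inner ℝ (v i) x ≤ d * l := by
      rw [real_inner_smul_left, inner_neg_left, sum_inner] at hwx
      have h1 : -∑ i, inner ℝ (v i) x ≤ t⁻¹ := by
        rw [← one_div, le_div_iff₀ htpos]
        linarith
      exact h1.trans (by rw [inv_le_comm₀ htpos (by positivity)]; exact ht)
    refine hmemP _ fun p hp => ?_
    rw [inner_neg_right, real_inner_smul_right, ← mul_neg, inv_mul_le_iff₀ (by positivity), mul_one]
    have hp' := hrep p hp
    have hpx : inner ℝ p x = ∑ i, v.repr p i * inner ℝ (v i) x := by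
      conv_lhs => rw [← v.sum_repr p]
      simp only [sum_inner, real_inner_smul_left]
    have hbound : ∑ i, (1 - v.repr p i) * inner ℝ (v i) x ≤ ∑ _i : Fin d, (2 : ℝ) := by
      refine Finset.sum_le_sum fun i _ => ?_
      have h2 := abs_le.1 (hp' i)
      nlinarith [mul_le_mul_of_nonneg_left (hvx i) (sub_nonneg.2 h2.2)]
    simp only [sub_mul, one_mul, Finset.sum_sub_distrib, Finset.sum_const, Finset.card_univ,
      Fintype.card_fin, nsmul_eq_mul] at hbound
    rw [hpx]
    linarith

/-- A bounded finite intersection of closed convex sets with nonempty interior contains a negative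
homothetic copy, with ratio `((2 d + 3) d)⁻¹`, of the intersection of at most `2 d` of the sets. -/
theorem exists_card_le_forall_sub_smul_mem {ι E : Type*} [Finite ι] [NormedAddCommGroup E]
    [InnerProductSpace ℝ E] [FiniteDimensional ℝ E] {D : ι → Set E}
    (hconv : ∀ i, Convex ℝ (D i)) (hcl : ∀ i, IsClosed (D i))
    (hint : (interior (⋂ i, D i)).Nonempty) (hbdd : Bornology.IsBounded (⋂ i, D i))
    (hd : 0 < Module.finrank ℝ E) :
    ∃ (S : Finset ι) (z : E), S.card ≤ 2 * Module.finrank ℝ E ∧ ∀ x ∈ ⋂ i ∈ S, D i,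
      z - ((2 * Module.finrank ℝ E + 3) * Module.finrank ℝ E : ℝ)⁻¹ • (x - z) ∈ ⋂ i, D i := by
  obtain ⟨z, hz, hasym⟩ := (convex_iInter hconv).exists_mem_interior_forall_sub_smul_mem
    (Metric.isCompact_of_isClosed_isBounded (isClosed_iInter hcl) hbdd) hint hd
  have hpre : ⋂ i, (fun x => z + x) ⁻¹' D i = (fun x => z + x) ⁻¹' ⋂ i, D i := by
    rw [Set.preimage_iInter]
  obtain ⟨S, hS, h⟩ := exists_card_le_forall_neg_smul_mem
    (D := fun i => (fun x => z + x) ⁻¹' D i) (l := 2 * Module.finrank ℝ E + 1)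
    (fun i => (hconv i).translate_preimage_right z)
    (fun i => (hcl i).preimage (continuous_const.add continuous_id))
    (fun i => by
      rw [mem_interior_iff_mem_nhds]
      refine (continuous_const.add continuous_id).continuousAt.preimage_mem_nhds ?_
      simpa using Filter.mem_of_superset (mem_interior_iff_mem_nhds.1 hz) (Set.iInter_subset D i))
    (by
      rw [hpre, ← Homeomorph.coe_addLeft, ← (Homeomorph.addLeft z).image_symm]
      exact (IsometryEquiv.addLeft z).symm.isometry.lipschitz.isBounded_image hbdd)
    hd (by positivity)
    (fun x hx => by
      rw [hpre] at hx ⊢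
      have := hasym _ hx
      simpa [sub_eq_add_neg] using this)
  refine ⟨S, z, hS, fun x hx => ?_⟩
  have := h (x - z) (by simpa using hx)
  rw [hpre, Set.mem_preimage, ← sub_eq_add_neg, add_assoc] at this
  norm_num at this
  simpa using this

theorem Convex.interior_nonempty_of_measure_ne_zero {E : Type*} [NormedAddCommGroup E]
    [NormedSpace ℝ E] [MeasurableSpace E] [BorelSpace E] [FiniteDimensional ℝ E]
    (μ : Measure E) [μ.IsAddHaarMeasure] {s : Set E} (hs : Convex ℝ s) (h : μ s ≠ 0) :
    (interior s).Nonempty := by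
  by_contra hne
  rw [Set.not_nonempty_iff_eq_empty] at hne
  refine h (measure_mono_null ?_ (hs.addHaar_frontier μ))
  rw [frontier, hne, Set.sdiff_empty]
  exact subset_closure

/-- Volumetric Helly theorem for compact convex sets. -/
theorem le_measure_iInter_of_isCompact {ι E : Type*} [Fintype ι] [NormedAddCommGroup E]
    [InnerProductSpace ℝ E] [FiniteDimensional ℝ E] [MeasurableSpace E] [BorelSpace E]
    (μ : Measure E) [μ.IsAddHaarMeasure] {D : ι → Set E} (hd : 0 < Module.finrank ℝ E)
    (hcard : 2 * Module.finrank ℝ E ≤ Fintype.card ι)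
    (hconv : ∀ i, Convex ℝ (D i)) (hcpt : ∀ i, IsCompact (D i)) {m : ENNReal} (hm : m ≠ 0)
    (h : ∀ S : Finset ι, S.card = 2 * Module.finrank ℝ E → m ≤ μ (⋂ i ∈ S, D i)) :
    ENNReal.ofReal
      (((2 * Module.finrank ℝ E + 3) * Module.finrank ℝ E : ℝ)⁻¹ ^ Module.finrank ℝ E) * m ≤
        μ (⋂ i, D i) := by
  have hle : ∀ S : Finset ι, S.card ≤ 2 * Module.finrank ℝ E → m ≤ μ (⋂ i ∈ S, D i) := by
    intro S hS
    obtain ⟨T, hST, hT⟩ := Finset.exists_superset_card_eq hS hcard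
    exact (h T hT).trans (measure_mono (Set.biInter_mono hST fun _ _ => subset_rfl))
  have hint : (interior (⋂ i, D i)).Nonempty := by
    have := Convex.helly_theorem' (𝕜 := ℝ) (F := fun i => interior (D i)) (s := Finset.univ)
      (fun i _ => (hconv i).interior) (fun I _ hI => by
        rw [← Finset.interior_iInter]
        exact (convex_iInter₂ fun i _ => hconv i).interior_nonempty_of_measure_ne_zero μ
          fun h0 => hm (le_zero_iff.1 (h0 ▸ hle I (by omega))))
    rw [interior_iInter_of_finite]
    simpa using this
  obtain ⟨i₀⟩ : Nonempty ι := Fintype.card_pos_iff.1 (by omega)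
  obtain ⟨S, z, hS, hsub⟩ := exists_card_le_forall_sub_smul_mem hconv (fun i => (hcpt i).isClosed)
    hint ((hcpt i₀).isBounded.subset (Set.iInter_subset D i₀)) hd
  set r := ((2 * Module.finrank ℝ E + 3) * Module.finrank ℝ E : ℝ)⁻¹ with hr
  have himage : AffineMap.homothety z (-r) '' (⋂ i ∈ S, D i) ⊆ ⋂ i, D i := by
    rintro _ ⟨x, hx, rfl⟩
    have := hsub x hx
    rwa [AffineMap.homothety_apply, vsub_eq_sub, vadd_eq_add, neg_smul, neg_add_eq_sub]
  calc ENNReal.ofReal (r ^ Module.finrank ℝ E) * m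
      ≤ ENNReal.ofReal |(-r) ^ Module.finrank ℝ E| * μ (⋂ i ∈ S, D i) := by
        have : |(-r) ^ Module.finrank ℝ E| = r ^ Module.finrank ℝ E := by
          rw [abs_pow, abs_neg, abs_of_nonneg (by positivity)]
        rw [this]
        gcongr
        exact hle S hS
    _ = μ (AffineMap.homothety z (-r) '' (⋂ i ∈ S, D i)) :=
        (Measure.addHaar_image_homothety μ z (-r) _).symm
    _ ≤ μ (⋂ i, D i) := measure_mono himage

/-- Volumetric Helly theorem for arbitrary convex sets. -/
theorem le_measure_iInter_of_convex {ι E : Type*} [Fintype ι] [NormedAddCommGroup E]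
    [InnerProductSpace ℝ E] [FiniteDimensional ℝ E] [MeasurableSpace E] [BorelSpace E]
    (μ : Measure E) [μ.IsAddHaarMeasure] {C : ι → Set E} (hd : 0 < Module.finrank ℝ E)
    (hcard : 2 * Module.finrank ℝ E ≤ Fintype.card ι) (hconv : ∀ i, Convex ℝ (C i))
    {m : ENNReal} (hm : m ≠ 0)
    (h : ∀ S : Finset ι, S.card = 2 * Module.finrank ℝ E → m < μ (⋂ i ∈ S, C i)) :
    ENNReal.ofReal
      (((2 * Module.finrank ℝ E + 3) * Module.finrank ℝ E : ℝ)⁻¹ ^ Module.finrank ℝ E) * m ≤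
        μ (⋂ i, C i) := by
  obtain ⟨k, hk⟩ : ∃ k : ℕ, ∀ S : Finset ι, S.card = 2 * Module.finrank ℝ E →
      m < μ ((⋂ i ∈ S, C i) ∩ Metric.closedBall 0 k) := by
    have hev : ∀ᶠ k : ℕ in Filter.atTop, ∀ S : Finset ι, S.card = 2 * Module.finrank ℝ E →
        m < μ ((⋂ i ∈ S, C i) ∩ Metric.closedBall 0 k) := by
      rw [Filter.eventually_all]
      intro S
      by_cases hS : S.card = 2 * Module.finrank ℝ E
      · have hmono : Monotone fun k : ℕ => (⋂ i ∈ S, C i) ∩ Metric.closedBall (0 : E) k :=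
          fun a b hab => Set.inter_subset_inter_right _
            (Metric.closedBall_subset_closedBall (by exact_mod_cast hab))
        have ht := tendsto_measure_iUnion_atTop (μ := μ) hmono
        rw [← Set.inter_iUnion, Metric.iUnion_closedBall_nat, Set.inter_univ] at ht
        filter_upwards [ht.eventually_const_lt (h S hS)] with k hk _
        exact hk
      · exact Filter.Eventually.of_forall fun k hS' => absurd hS' hS
    exact hev.exists
  have hmain := le_measure_iInter_of_isCompact μ
    (D := fun i => closure (C i) ∩ Metric.closedBall 0 k) hd hcard
    (fun i => (hconv i).closure.inter (convex_closedBall 0 _))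
    (fun i => (isCompact_closedBall 0 _).inter_left isClosed_closure) hm
    (fun S hS => (hk S hS).le.trans (measure_mono fun x hx => by
      have h1 := Set.mem_iInter₂.1 hx.1
      exact Set.mem_iInter₂.2 fun i hi => ⟨subset_closure (h1 i hi), hx.2⟩))
  refine hmain.trans ?_
  have hnull : μ (⋃ i, frontier (C i)) = 0 :=
    measure_iUnion_null fun i => (hconv i).addHaar_frontier μ
  calc μ (⋂ i, closure (C i) ∩ Metric.closedBall 0 k)
      ≤ μ ((⋂ i, C i) ∪ ⋃ i, frontier (C i)) := by
        refine measure_mono fun x hx => ?_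
        by_contra hx'
        simp only [Set.mem_union, Set.mem_iInter, Set.mem_iUnion, not_or, not_forall,
          not_exists] at hx'
        obtain ⟨⟨i, hi⟩, hfr⟩ := hx'
        exact hfr i ⟨(Set.mem_iInter.1 hx i).1, fun hint => hi (interior_subset hint)⟩
    _ ≤ μ (⋂ i, C i) + μ (⋃ i, frontier (C i)) := measure_union_le _ _
    _ = μ (⋂ i, C i) := by rw [hnull, add_zero]

/-- Quantitative Volume Theorem (Bárány–Katchalski–Pach, with Brazitikos's bound). -/
theorem quantitative_volume_theorem :
    ∃ c : ℝ, 0 < c ∧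
      ∀ d : ℕ, 1 ≤ d →
        ∀ n : ℕ, 2 * d ≤ n →
          ∀ C : Fin n → Set (EuclideanSpace ℝ (Fin d)),
            (∀ i, Convex ℝ (C i)) →
            (∀ S : Finset (Fin n), S.card = 2 * d →
              1 ≤ volume (⋂ i ∈ S, C i)) →
            ENNReal.ofReal
                (c ^ d * (d : ℝ) ^ (-(3 * (d : ℝ) / 2)) *
                  (d : ℝ) ^ (-(d : ℝ))) ≤
              volume (⋂ i, C i) := by
  refine ⟨1 / 10, by norm_num, fun d hd n hn C hconv hvol => ?_⟩
  have hfin : Module.finrank ℝ (EuclideanSpace ℝ (Fin d)) = d := finrank_euclideanSpace_fin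
  have hmain := le_measure_iInter_of_convex (volume : Measure (EuclideanSpace ℝ (Fin d)))
    (C := C) (m := ENNReal.ofReal (1 / 2)) (by omega) (by simpa using hn) hconv
    (by simp) (fun S hS => lt_of_lt_of_le
      (ENNReal.ofReal_lt_one.2 (by norm_num)) (hvol S (by omega)))
  rw [hfin] at hmain
  refine le_trans ?_ hmain
  have hd1 : (1 : ℝ) ≤ d := by exact_mod_cast hd
  have hd0 : (0 : ℝ) < d := by linarith
  rw [← ENNReal.ofReal_mul (by positivity)]
  refine ENNReal.ofReal_le_ofReal ?_
  have h1 : (d : ℝ) ^ (-(3 * (d : ℝ) / 2)) * (d : ℝ) ^ (-(d : ℝ)) ≤ ((d : ℝ) ^ 2)⁻¹ ^ d := by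
    rw [← Real.rpow_add hd0, ← Real.rpow_natCast, ← Real.rpow_natCast, ← Real.rpow_neg hd0.le,
      ← Real.rpow_mul hd0.le]
    refine Real.rpow_le_rpow_of_exponent_le hd1 ?_
    push_cast
    linarith
  have h2 : (1 / 2 : ℝ) ^ d ≤ 1 / 2 := pow_le_of_le_one (by norm_num) (by norm_num) (by omega)
  have h3 : (1 / 5 : ℝ) * ((d : ℝ) ^ 2)⁻¹ ≤ ((2 * d + 3) * d : ℝ)⁻¹ := by
    rw [one_div, ← mul_inv]
    refine inv_anti₀ (by positivity) ?_
    nlinarith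
  calc (1 / 10 : ℝ) ^ d * (d : ℝ) ^ (-(3 * (d : ℝ) / 2)) * (d : ℝ) ^ (-(d : ℝ))
      = (1 / 10 : ℝ) ^ d * ((d : ℝ) ^ (-(3 * (d : ℝ) / 2)) * (d : ℝ) ^ (-(d : ℝ))) := by ring
    _ ≤ (1 / 10 : ℝ) ^ d * ((d : ℝ) ^ 2)⁻¹ ^ d := by gcongr
    _ = ((1 / 5 : ℝ) * ((d : ℝ) ^ 2)⁻¹) ^ d * (1 / 2) ^ d := by
        rw [← mul_pow, ← mul_pow]
        congr 1
        ring
    _ ≤ ((2 * d + 3) * d : ℝ)⁻¹ ^ d * (1 / 2) := by gcongr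
end

section
/- Tverberg's Theorem: For every dimension d ≥ 1 and integer r ≥ 1, if m ≥ (r−1)(d+1)+1 and x₁, …, x_m is a (multi)set of m points in ℝ^d, then there is a partition {1,…,m} = I₁ ∪ … ∪ I_r into r pairwise disjoint parts such that ⋂_{i=1}^{r} conv{x_j : j ∈ Iᵢ} is nonempty. -/
/-- A point of minimal norm of a convex set supports that set. -/
theorem Convex.sq_norm_le_inner_of_forall_norm_le {E : Type*} [NormedAddCommGroup E]
    [InnerProductSpace ℝ E] {K : Set E} (hK : Convex ℝ K) {p : E} (hp : p ∈ K)
    (hmin : ∀ y ∈ K, ‖p‖ ≤ ‖y‖) {y : E} (hy : y ∈ K) : ‖p‖ ^ 2 ≤ inner ℝ p y := by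
  have : Nonempty K := ⟨⟨p, hp⟩⟩
  have h := (norm_eq_iInf_iff_real_inner_le_zero hK (u := 0) hp).1 (le_antisymm
    (le_ciInf fun w => by simpa using hmin w w.2)
    (ciInf_le ⟨0, by rintro _ ⟨w, rfl⟩; positivity⟩ (⟨p, hp⟩ : K))) y hy
  rw [zero_sub, inner_neg_left, inner_sub_right, real_inner_self_eq_norm_sq] at h
  linarith

/-- An affinely independent family lying on a hyperplane that misses the origin is linearly
independent. -/
theorem AffineIndependent.linearIndependent_of_map_eq {𝕜 E ι : Type*} [Field 𝕜]
    [AddCommGroup E] [Module 𝕜 E] {z : ι → E} (hz : AffineIndependent 𝕜 z) (φ : E →ₗ[𝕜] 𝕜)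
    {c : 𝕜} (hc : c ≠ 0) (hφ : ∀ i, φ (z i) = c) : LinearIndependent 𝕜 z := by
  rw [linearIndependent_iff']
  intro s g hg
  refine affineIndependent_iff.1 hz s g ?_ hg
  have h := congrArg φ hg
  simp only [map_sum, map_smul, hφ, smul_eq_mul, ← Finset.sum_mul, map_zero] at h
  exact (mul_eq_zero.1 h).resolve_right hc

/-- The nearest point to the origin of the convex hull of a family with more members than the
dimension, if it is not the origin, lies in the convex hull of the family with some index
removed. -/
theorem exists_mem_convexHull_image_compl_of_forall_norm_le {E ι : Type*} [NormedAddCommGroup E]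
    [InnerProductSpace ℝ E] [FiniteDimensional ℝ E] [Fintype ι]
    (hι : Module.finrank ℝ E < Fintype.card ι) (v : ι → E) {p : E} (hp0 : p ≠ 0)
    (hp : p ∈ convexHull ℝ (Set.range v)) (hmin : ∀ y ∈ convexHull ℝ (Set.range v), ‖p‖ ≤ ‖y‖) :
    ∃ j, p ∈ convexHull ℝ (v '' {j}ᶜ) := by
  classical
  obtain ⟨κ, _, z, w, hz, hind, hw, hw1, hwz⟩ := eq_pos_convex_span_of_mem_convexHull hp
  have hzp : ∀ k, ‖p‖ ^ 2 ≤ inner ℝ p (z k) := fun k =>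
    (convex_convexHull ℝ _).sq_norm_le_inner_of_forall_norm_le hp hmin
      (subset_convexHull ℝ _ (hz ⟨k, rfl⟩))
  have hsum : ∑ k, w k * ‖p‖ ^ 2 = ∑ k, w k * inner ℝ p (z k) := by
    rw [← Finset.sum_mul, hw1, one_mul, ← real_inner_self_eq_norm_sq]
    conv_lhs => rw [← hwz, inner_sum, hwz]
    simp only [inner_smul_right]
  have heq := (Finset.sum_eq_sum_iff_of_le fun k _ =>
    mul_le_mul_of_nonneg_left (hzp k) (hw k).le).1 hsum
  have hlin : LinearIndependent ℝ z :=
    hind.linearIndependent_of_map_eq (innerₛₗ ℝ p) (c := ‖p‖ ^ 2) (by simpa using hp0)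
      fun k => (mul_left_cancel₀ (hw k).ne' (heq k (Finset.mem_univ k))).symm
  choose g hg using fun k => hz ⟨k, rfl⟩
  obtain ⟨j, hj⟩ : ∃ j, j ∉ Set.range g := by
    by_contra! h
    exact absurd (Fintype.card_le_of_surjective g h)
      (hlin.fintype_card_le_finrank.trans_lt hι).not_ge
  refine ⟨j, mem_convexHull_of_exists_fintype w z (fun k => (hw k).le) hw1 (fun k => ?_) hwz⟩
  exact ⟨g k, fun h => hj ⟨k, h⟩, hg k⟩

/-- **Colorful Carathéodory theorem**. -/
theorem exists_zero_mem_convexHull_range_of_forall {E ι κ : Type*} [NormedAddCommGroup E]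
    [InnerProductSpace ℝ E] [FiniteDimensional ℝ E] [Fintype ι] [Finite κ]
    (hι : Module.finrank ℝ E < Fintype.card ι) (v : ι → κ → E)
    (hv : ∀ j, (0 : E) ∈ convexHull ℝ (Set.range (v j))) :
    ∃ f : ι → κ, (0 : E) ∈ convexHull ℝ (Set.range fun j => v j (f j)) := by
  classical
  have : Nonempty ι := Fintype.card_pos_iff.1 (by omega)
  have : Nonempty κ := by
    have h := convexHull_nonempty_iff.1 ⟨0, hv (Classical.arbitrary ι)⟩
    exact Set.range_nonempty_iff_nonempty.1 h
  have hnear : ∀ f : ι → κ, ∃ p ∈ convexHull ℝ (Set.range fun j => v j (f j)),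
      ∀ y ∈ convexHull ℝ (Set.range fun j => v j (f j)), ‖p‖ ≤ ‖y‖ := fun f =>
    ((Set.finite_range fun j => v j (f j)).isCompact_convexHull ℝ).exists_isMinOn
      (Set.range_nonempty _).convexHull continuous_norm.continuousOn
  choose p hp hmin using hnear
  obtain ⟨f, hf⟩ := Finite.exists_min fun f => ‖p f‖
  refine ⟨f, ?_⟩
  by_cases hp0 : p f = 0
  · exact hp0 ▸ hp f
  exfalso
  obtain ⟨j, hj⟩ :=
    exists_mem_convexHull_image_compl_of_forall_norm_le hι _ hp0 (hp f) (hmin f)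
  obtain ⟨i, hi⟩ : ∃ i, inner ℝ (p f) (v j i) ≤ 0 := by
    by_contra! h
    have := convexHull_min
      (show Set.range (v j) ⊆ {y | 0 < innerₛₗ ℝ (p f) y} from Set.range_subset_iff.2 h)
      (convex_halfSpace_gt (innerₛₗ ℝ (p f)).isLinear 0) (hv j)
    simp at this
  have hpmem : p f ∈ convexHull ℝ (Set.range fun k => v k (Function.update f j i k)) := by
    refine convexHull_mono ?_ hj
    rintro _ ⟨k, hk, rfl⟩
    exact ⟨k, by simp [Function.update_of_ne (show k ≠ j from hk)]⟩
  have h := (convex_convexHull ℝ _).sq_norm_le_inner_of_forall_norm_le hpmem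
    (fun y hy => (hf _).trans (hmin _ y hy))
    (subset_convexHull ℝ _ ⟨j, rfl⟩)
  simp only [Function.update_self] at h
  have : 0 < ‖p f‖ := norm_pos_iff.2 hp0
  nlinarith

/-- The vectors `e₀, …, e_{s-1}, -(e₀ + ⋯ + e_{s-1})` of `ℝˢ`, given by their coordinates. -/
def zeroSumCoord {s : ℕ} (i : Fin (s + 1)) (a : Fin s) : ℝ :=
  if i = a.castSucc then 1 else if i = Fin.last s then -1 else 0

theorem sum_zeroSumCoord_mul {s : ℕ} (a : Fin s) (c : Fin (s + 1) → ℝ) :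
    ∑ i, zeroSumCoord i a * c i = c a.castSucc - c (Fin.last s) := by
  have h : ∀ i, zeroSumCoord i a * c i =
      (if i = a.castSucc then c i else 0) - (if i = Fin.last s then c i else 0) := by
    intro i
    have := (Fin.castSucc_lt_last a).ne'
    unfold zeroSumCoord
    split_ifs <;> simp_all
  simp [h, Finset.sum_sub_distrib]

/-- The tensor of the point `x`, lifted to height one, with the `i`-th zero-sum vector. -/
noncomputable def sarkariaVector {d s : ℕ} (x : EuclideanSpace ℝ (Fin d)) (i : Fin (s + 1)) :
    EuclideanSpace ℝ (Fin s × Option (Fin d)) :=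
  WithLp.toLp 2 fun q => zeroSumCoord i q.1 * q.2.elim 1 x

theorem zero_mem_convexHull_range_sarkariaVector {d s : ℕ} (x : EuclideanSpace ℝ (Fin d)) :
    (0 : EuclideanSpace ℝ (Fin s × Option (Fin d))) ∈
      convexHull ℝ (Set.range (sarkariaVector (s := s) x)) := by
  refine mem_convexHull_of_exists_fintype (fun _ : Fin (s + 1) => ((s : ℝ) + 1)⁻¹)
    (sarkariaVector x) (fun _ => by positivity) ?_ (fun i => ⟨i, rfl⟩) ?_
  · simp only [Finset.sum_const, Finset.card_univ, Fintype.card_fin, nsmul_eq_mul]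
    push_cast
    exact mul_inv_cancel₀ (by positivity)
  · ext ⟨a, b⟩
    have h := sum_zeroSumCoord_mul a fun _ => b.elim 1 x
    simp only [sub_self] at h
    simp [sarkariaVector, ← Finset.smul_sum, h]

/-- A convex dependence between Sarkaria vectors yields a common point of the convex hulls of the
color classes. -/
theorem nonempty_iInter_convexHull_of_zero_mem {d s : ℕ} {ι : Type*}
    (x : ι → EuclideanSpace ℝ (Fin d)) (f : ι → Fin (s + 1))
    (h : (0 : EuclideanSpace ℝ (Fin s × Option (Fin d))) ∈
      convexHull ℝ (Set.range fun j => sarkariaVector (x j) (f j))) :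
    (⋂ i, convexHull ℝ (x '' {j | f j = i})).Nonempty := by
  classical
  obtain ⟨κ, _, w, z, hw, hw1, hz, hwz⟩ := mem_convexHull_iff_exists_fintype.1 h
  choose g hg using hz
  have hcoord : ∀ (b : Option (Fin d)) (i : Fin (s + 1)),
      ∑ k with f (g k) = i, w k * b.elim 1 (x (g k)) =
        ∑ k with f (g k) = Fin.last s, w k * b.elim 1 (x (g k)) := by
    intro b i
    induction i using Fin.lastCases with
    | last => rfl
    | cast a =>
      rw [← sub_eq_zero, ← sum_zeroSumCoord_mul a fun i =>
        ∑ k with f (g k) = i, w k * b.elim 1 (x (g k))]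
      have h0 : ∑ k, w k * (zeroSumCoord (f (g k)) a * b.elim 1 (x (g k))) = 0 := by
        simpa [← hg, sarkariaVector] using
          congrArg (fun y : EuclideanSpace ℝ (Fin s × Option (Fin d)) => y (a, b)) hwz
      rw [← h0, ← Finset.sum_fiberwise Finset.univ (fun k => f (g k))]
      refine Finset.sum_congr rfl fun i _ => ?_
      rw [Finset.mul_sum]
      refine Finset.sum_congr rfl fun k hk => ?_
      rw [(Finset.mem_filter.1 hk).2]
      ring
  have hweight : ∀ i, ∑ k with f (g k) = i, w k = ∑ k with f (g k) = Fin.last s, w k :=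
    fun i => by simpa using hcoord none i
  have hpoint : ∀ i, ∑ k with f (g k) = i, w k • x (g k) =
      ∑ k with f (g k) = Fin.last s, w k • x (g k) := by
    intro i
    ext b
    simpa using hcoord (some b) i
  have hpos : 0 < ∑ k with f (g k) = Fin.last s, w k := by
    refine (Finset.sum_nonneg fun k _ => hw k).lt_of_ne' fun h0 => ?_
    rw [← Finset.sum_fiberwise Finset.univ (fun k => f (g k))] at hw1
    simp [hweight, h0] at hw1
  refine ⟨Finset.centerMass {k | f (g k) = Fin.last s} w (x ∘ g), Set.mem_iInter.2 fun i => ?_⟩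
  have hc : Finset.centerMass {k | f (g k) = Fin.last s} w (x ∘ g) =
      Finset.centerMass {k | f (g k) = i} w (x ∘ g) := by
    simp only [Finset.centerMass, Function.comp_apply, hweight i, hpoint i]
  rw [hc]
  exact Finset.centerMass_mem_convexHull _ (fun k _ => hw k) (hweight i ▸ hpos)
    fun k hk => ⟨g k, (Finset.mem_filter.1 hk).2, rfl⟩

/-- Tverberg's Theorem. -/
theorem tverberg
    (d : ℕ) (hd : 1 ≤ d) (r : ℕ) (hr : 1 ≤ r)
    (m : ℕ) (hm : (r - 1) * (d + 1) + 1 ≤ m)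
    (x : Fin m → EuclideanSpace ℝ (Fin d)) :
    ∃ f : Fin m → Fin r,
      (⋂ i : Fin r, convexHull ℝ (x '' {j : Fin m | f j = i})).Nonempty := by
  obtain ⟨s, rfl⟩ := Nat.exists_eq_add_of_le' hr
  have hdim : Module.finrank ℝ (EuclideanSpace ℝ (Fin s × Option (Fin d))) <
      Fintype.card (Fin m) := by
    simpa using hm
  obtain ⟨f, hf⟩ := exists_zero_mem_convexHull_range_of_forall hdim
    (fun j => sarkariaVector (s := s) (x j))
    fun j => zero_mem_convexHull_range_sarkariaVector (x j)
  exact ⟨f, nonempty_iInter_convexHull_of_zero_mem x f hf⟩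
end

section
/- Selection Lemma (Boros–Füredi, Bárány): For every dimension d ≥ 1 there exists λ = λ(d) ∈ (0,1) with the following property. If x₁, …, xₙ is a (multi)set of n ≥ d+1 points in ℝ^d, then there is a collection ℋ of (d+1)-element subsets of {1,…,n} with |ℋ| ≥ λ · C(n, d+1) such that the intersection ⋂_{I ∈ ℋ} conv{x_j : j ∈ I} is nonempty. -/
open Module

/-- **Colorful Carathéodory theorem** (Bárány). -/
theorem colorful_caratheodory {E : Type*} [NormedAddCommGroup E] [InnerProductSpace ℝ E]
    [FiniteDimensional ℝ E] {d : ℕ} (hd : finrank ℝ E = d) (A : Fin (d + 1) → Finset E) (p : E)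
    (hA : ∀ i, p ∈ convexHull ℝ (A i : Set E)) :
    ∃ a : Fin (d + 1) → E, (∀ i, a i ∈ A i) ∧ p ∈ convexHull ℝ (Set.range a) := by
  classical
  have hne : (Fintype.piFinset A).Nonempty :=
    Fintype.piFinset_nonempty.2 fun i ↦
      Finset.coe_nonempty.1 (convexHull_nonempty_iff.1 ⟨p, hA i⟩)
  obtain ⟨a, ha, hmin⟩ := Finset.exists_min_image _
    (fun a ↦ Metric.infDist p (convexHull ℝ (Set.range a))) hne
  rw [Fintype.mem_piFinset] at ha
  refine ⟨a, ha, ?_⟩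
  have hK : IsCompact (convexHull ℝ (Set.range a)) := (Set.finite_range a).isCompact_convexHull ℝ
  obtain ⟨z, hz, hzp⟩ := hK.exists_infDist_eq_dist (Set.range_nonempty a).convexHull p
  by_contra hp
  have hpz : p - z ≠ 0 := fun h ↦ hp (sub_eq_zero.1 h ▸ hz)
  -- the variational inequality at a point realizing the distance
  have hvar : ∀ K : Set E, Convex ℝ K → z ∈ K → dist p z ≤ Metric.infDist p K →
      ∀ w ∈ K, inner ℝ (p - z) (w - z) ≤ 0 := by
    intro K hKc hzK hle
    refine (norm_eq_iInf_iff_real_inner_le_zero hKc hzK).1 ?_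
    rw [← dist_eq_norm, le_antisymm hle (Metric.infDist_le_dist_of_mem hzK),
      Metric.infDist_eq_iInf]
    simp only [dist_eq_norm]
  have hvarz := hvar _ (convex_convexHull ℝ _) hz hzp.ge
  obtain ⟨ι, _, y, w, hy, hind, hw, hw1, hwz⟩ := eq_pos_convex_span_of_mem_convexHull hz
  have hface : ∀ k, inner ℝ (p - z) (y k - z) = 0 := by
    have hle : ∀ k ∈ Finset.univ, w k * inner ℝ (p - z) (y k - z) ≤ 0 := fun k _ ↦
      mul_nonpos_of_nonneg_of_nonpos (hw k).le
        (hvarz _ (subset_convexHull ℝ _ (hy ⟨k, rfl⟩)))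
    have hsum : ∑ k, w k * inner ℝ (p - z) (y k - z) = 0 := by
      simp_rw [← inner_smul_right, ← inner_sum, smul_sub, Finset.sum_sub_distrib,
        ← Finset.sum_smul, hwz, hw1]
      simp
    intro k
    have := (Finset.sum_eq_zero_iff_of_nonpos hle).1 hsum k (Finset.mem_univ k)
    exact (mul_eq_zero.1 this).resolve_left (hw k).ne'
  have hcard : Fintype.card ι < d + 1 := by
    have hle : vectorSpan ℝ (Set.range y) ≤ (Submodule.span ℝ {p - z})ᗮ := by
      rw [vectorSpan_def, Submodule.span_le]
      rintro _ ⟨_, ⟨k, rfl⟩, _, ⟨l, rfl⟩, rfl⟩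
      rw [SetLike.mem_coe, Submodule.mem_orthogonal_singleton_iff_inner_right]
      have : y k -ᵥ y l = (y k - z) - (y l - z) := by simp
      simp only [this, inner_sub_right (𝕜 := ℝ) (p - z) (y k - z), hface, sub_zero]
    have h1 := hind.card_le_finrank_succ
    have h2 := Submodule.finrank_mono hle
    have h3 := (Submodule.span ℝ {p - z}).finrank_add_finrank_orthogonal
    rw [finrank_span_singleton hpz] at h3
    omega
  choose σ hσ using fun k ↦ hy ⟨k, rfl⟩
  obtain ⟨i, hi⟩ : ∃ i, ∀ k, σ k ≠ i := by
    by_contra! h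
    have := Fintype.card_le_of_surjective σ h
    simp at this
    omega
  obtain ⟨b, hb, hbpos⟩ : ∃ b ∈ A i, 0 < inner ℝ (p - z) (b - z) := by
    by_contra! h
    have hconv : Convex ℝ {b | inner ℝ (p - z) b ≤ inner ℝ (p - z) z} :=
      convex_halfSpace_le (innerₛₗ ℝ (p - z)).isLinear _
    have hsub : (A i : Set E) ⊆ {b | inner ℝ (p - z) b ≤ inner ℝ (p - z) z} := fun b hb ↦ by
      simpa [inner_sub_right] using h b hb
    have := convexHull_min hsub hconv (hA i)
    rw [Set.mem_ofPred_eq, ← sub_nonpos, ← inner_sub_right] at this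
    exact hpz (real_inner_self_nonpos.1 this)
  set a' := Function.update a i b with ha'
  have hzK : z ∈ convexHull ℝ (Set.range a') := by
    rw [← hwz]
    refine (convex_convexHull ℝ _).sum_mem (fun k _ ↦ (hw k).le) hw1 fun k _ ↦
      subset_convexHull ℝ _ ⟨σ k, ?_⟩
    rw [ha', Function.update_of_ne (hi k), hσ]
  have hmem : a' ∈ Fintype.piFinset A := by
    rw [Fintype.mem_piFinset]
    intro j
    rcases eq_or_ne j i with rfl | hj
    · simpa [ha'] using hb
    · simpa [ha', hj] using ha j
  refine (hvar _ (convex_convexHull ℝ _) hzK (hzp ▸ hmin a' hmem) b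
    (subset_convexHull ℝ _ ⟨i, ?_⟩)).not_gt hbpos
  simp [ha']

/-- **Centerpoint theorem**: some point lies in the convex hull of every subfamily that omits
fewer than a `1 / (finrank ℝ E + 1)` fraction of the points. -/
theorem exists_centerpoint {E ι : Type*} [AddCommGroup E] [Module ℝ E] [FiniteDimensional ℝ E]
    [Fintype ι] [DecidableEq ι] (x : ι → E) :
    ∃ p, ∀ U : Finset ι, (finrank ℝ E + 1) * U.card < Fintype.card ι →
      p ∈ convexHull ℝ (x '' ↑Uᶜ) := by
  obtain ⟨p, hp⟩ := Convex.helly_theorem' (𝕜 := ℝ)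
    (F := fun U : Finset ι ↦ convexHull ℝ (x '' ↑Uᶜ))
    (s := {U : Finset ι | (finrank ℝ E + 1) * U.card < Fintype.card ι})
    (fun _ _ ↦ convex_convexHull ℝ _) (by
      intro I hI hIc
      rcases I.eq_empty_or_nonempty with rfl | hIne
      · simp
      obtain ⟨j, hj⟩ : ∃ j, j ∉ I.biUnion id := by
        by_contra! h
        have h1 : (I.biUnion id).card = Fintype.card ι := by
          rw [Finset.eq_univ_iff_forall.2 h, Finset.card_univ]
        have h2 : (I.biUnion id).card ≤ ∑ U ∈ I, U.card := Finset.card_biUnion_le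
        have h3 : ∑ U ∈ I, (finrank ℝ E + 1) * U.card < ∑ _U ∈ I, Fintype.card ι :=
          Finset.sum_lt_sum_of_nonempty hIne fun U hU ↦ (Finset.mem_filter.1 (hI hU)).2
        rw [← Finset.mul_sum, Finset.sum_const, smul_eq_mul] at h3
        nlinarith
      refine ⟨x j, Set.mem_iInter₂.2 fun U hU ↦ subset_convexHull ℝ _ ⟨j, ?_, rfl⟩⟩
      simp only [Finset.mem_biUnion, id, not_exists, not_and] at hj
      simpa using hj U hU)
  refine ⟨p, fun U hU ↦ Set.mem_iInter₂.1 hp U ?_⟩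
  simpa using hU

/-- **Carathéodory's theorem** for indexed families. -/
theorem exists_subset_card_le_mem_convexHull_image {E ι : Type*} [AddCommGroup E] [Module ℝ E]
    [FiniteDimensional ℝ E] (x : ι → E) {T : Finset ι} {p : E} (hp : p ∈ convexHull ℝ (x '' ↑T)) :
    ∃ I ⊆ T, I.card ≤ finrank ℝ E + 1 ∧ p ∈ convexHull ℝ (x '' ↑I) := by
  classical
  obtain ⟨κ, _, y, w, hy, hind, hw, hw1, hwp⟩ := eq_pos_convex_span_of_mem_convexHull hp
  choose σ hσT hσ using fun k ↦ hy ⟨k, rfl⟩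
  refine ⟨Finset.univ.image σ, ?_, ?_, ?_⟩
  · intro i hi
    obtain ⟨k, -, rfl⟩ := Finset.mem_image.1 hi
    exact hσT k
  · have h1 := hind.card_le_finrank_succ
    have h2 := (vectorSpan ℝ (Set.range y)).finrank_le
    exact Finset.card_image_le.trans (by rw [Finset.card_univ]; omega)
  · rw [← hwp]
    exact (convex_convexHull ℝ _).sum_mem (fun k _ ↦ (hw k).le) hw1 fun k _ ↦
      subset_convexHull ℝ _ ⟨σ k, by simp, hσ k⟩

/-- Any finite family of points admits many pairwise disjoint subfamilies whose convex hulls share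
a point. -/
theorem exists_pairwise_disjoint_mem_convexHull {E ι : Type*} [AddCommGroup E] [Module ℝ E]
    [FiniteDimensional ℝ E] [Fintype ι] [DecidableEq ι] (x : ι → E) :
    ∃ p, ∀ r, (finrank ℝ E + 1) ^ 2 * r < Fintype.card ι + (finrank ℝ E + 1) ^ 2 →
      ∃ S : Fin r → Finset ι, Pairwise (Function.onFun Disjoint S) ∧
        ∀ i, p ∈ convexHull ℝ (x '' ↑(S i)) := by
  obtain ⟨p, hp⟩ := exists_centerpoint x
  refine ⟨p, fun r hr ↦ ?_⟩
  suffices ∃ S : Fin r → Finset ι, Pairwise (Function.onFun Disjoint S) ∧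
      ∀ i, (S i).card ≤ finrank ℝ E + 1 ∧ p ∈ convexHull ℝ (x '' ↑(S i)) by
    obtain ⟨S, hS, h⟩ := this
    exact ⟨S, hS, fun i ↦ (h i).2⟩
  induction r with
  | zero => exact ⟨fun _ ↦ ∅, fun i ↦ i.elim0, fun i ↦ i.elim0⟩
  | succ r ih =>
    obtain ⟨S, hS, h⟩ := ih (by nlinarith)
    set U := Finset.univ.biUnion S with hU
    have hUc : U.card ≤ r * (finrank ℝ E + 1) := by
      simpa using Finset.card_biUnion_le_card_mul Finset.univ S _ fun i _ ↦ (h i).1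
    obtain ⟨I, hIU, hIc, hpI⟩ :=
      exists_subset_card_le_mem_convexHull_image x (hp U (by nlinarith))
    have hdisj : ∀ i, Disjoint I (S i) := fun i ↦
      (Finset.disjoint_left.2 fun j hj ↦ Finset.mem_compl.1 (hIU hj)).mono_right
        (Finset.subset_biUnion_of_mem S (Finset.mem_univ i))
    refine ⟨Fin.cons I S, fun i j hij ↦ ?_, fun i ↦ ?_⟩
    · cases i using Fin.cases <;> cases j using Fin.cases
      · exact absurd rfl hij
      · exact hdisj _
      · exact (hdisj _).symm
      · exact hS fun h ↦ hij (congrArg _ h)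
    · cases i using Fin.cases
      · exact ⟨hIc, hpI⟩
      · exact h _

/-- Every family of `r` disjoint sets of points with `p` in their convex hulls yields
`r.choose (d + 1)` simplices containing `p`. -/
theorem exists_simplices_of_pairwise_disjoint {E ι : Type*} [NormedAddCommGroup E]
    [InnerProductSpace ℝ E] [FiniteDimensional ℝ E] [DecidableEq ι] {d : ℕ}
    (hd : finrank ℝ E = d) (x : ι → E) {r : ℕ} (S : Fin r → Finset ι) (p : E)
    (hS : Pairwise (Function.onFun Disjoint S)) (hp : ∀ i, p ∈ convexHull ℝ (x '' ↑(S i))) :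
    ∃ H : Finset (Finset ι), (∀ I ∈ H, I.card = d + 1) ∧ H.card = r.choose (d + 1) ∧
      ∀ I ∈ H, p ∈ convexHull ℝ (x '' ↑I) := by
  classical
  have hS' : ∀ {i j : Fin r} {k : ι}, k ∈ S i → k ∈ S j → i = j := fun hi hj ↦ by
    by_contra hij
    exact Finset.disjoint_left.1 (hS hij) hi hj
  have key : ∀ e : Fin (d + 1) ↪o Fin r, ∃ g : Fin (d + 1) → ι, (∀ i, g i ∈ S (e i)) ∧
      p ∈ convexHull ℝ (x '' ↑(Finset.univ.image g)) := by
    intro e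
    obtain ⟨a, ha, hpa⟩ := colorful_caratheodory hd (fun i ↦ (S (e i)).image x) p
      fun i ↦ by simpa using hp (e i)
    choose g hg hxg using fun i ↦ Finset.mem_image.1 (ha i)
    refine ⟨g, hg, ?_⟩
    rwa [Finset.coe_image, Finset.coe_univ, Set.image_univ, ← Set.range_comp,
      show x ∘ g = a from funext hxg]
  choose g hg hpg using key
  have hinj : Function.Injective fun e ↦ Finset.univ.image (g e) := by
    have hsub : ∀ e f, Finset.univ.image (g e) ⊆ Finset.univ.image (g f) →
        Set.range e ⊆ Set.range f := by
      rintro e f h _ ⟨i, rfl⟩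
      obtain ⟨j, -, hj⟩ := Finset.mem_image.1
        (h (Finset.mem_image_of_mem (g e) (Finset.mem_univ i)))
      exact ⟨j, hS' (hg f j) (hj ▸ hg e i)⟩
    intro e f h
    exact OrderEmbedding.range_inj.1 ((hsub e f h.le).antisymm (hsub f e h.ge))
  refine ⟨Finset.univ.image fun e ↦ Finset.univ.image (g e), ?_, ?_, ?_⟩
  · simp only [Finset.forall_mem_image]
    intro e _
    rw [Finset.card_image_of_injective, Finset.card_univ, Fintype.card_fin]
    exact fun i j hij ↦ e.injective (hS' (hg e i) (hij ▸ hg e j))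
  · rw [Finset.card_image_of_injective _ hinj, Finset.card_univ, ← Nat.card_eq_fintype_card,
      Nat.card_congr Set.powersetCard.ofFinEmbEquiv, Set.powersetCard.card, Nat.card_fin]
  · simp only [Finset.forall_mem_image]
    exact fun e _ ↦ hpg e

/-- A linear lower bound on `r` in terms of `n` bounds `n.choose D` by a constant multiple of
`r.choose D`. -/
theorem choose_le_pow_mul_choose {D n r : ℕ} (hD : 0 < D) (hDr : D ≤ r) (hn : n ≤ D ^ 2 * r) :
    n.choose D ≤ D ^ (3 * D) * r.choose D := by
  have h1 : r ≤ D * (r + 1 - D) := by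
    obtain ⟨k, rfl⟩ := Nat.exists_eq_add_of_le hDr
    rw [show D + k + 1 - D = k + 1 by omega]
    nlinarith
  have h2 : n ≤ D ^ 3 * (r + 1 - D) :=
    hn.trans (by rw [pow_succ D 2, mul_assoc]; exact Nat.mul_le_mul_left _ h1)
  refine Nat.le_of_mul_le_mul_left (c := D.factorial) ?_ D.factorial_pos
  calc D.factorial * n.choose D = n.descFactorial D :=
        (Nat.descFactorial_eq_factorial_mul_choose n D).symm
    _ ≤ n ^ D := Nat.descFactorial_le_pow n D
    _ ≤ (D ^ 3 * (r + 1 - D)) ^ D := Nat.pow_le_pow_left h2 D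
    _ = D ^ (3 * D) * (r + 1 - D) ^ D := by rw [mul_pow, ← pow_mul]
    _ ≤ D ^ (3 * D) * r.descFactorial D :=
      Nat.mul_le_mul_left _ (Nat.pow_sub_le_descFactorial r D)
    _ = D.factorial * (D ^ (3 * D) * r.choose D) := by
      rw [Nat.descFactorial_eq_factorial_mul_choose]; ring

/-- Selection Lemma (Boros–Füredi, Bárány). -/
theorem selection_lemma (d : ℕ) (hd : 1 ≤ d) :
    ∃ lam : ℝ, lam ∈ Set.Ioo (0 : ℝ) 1 ∧
      ∀ n : ℕ, d + 1 ≤ n →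
        ∀ x : Fin n → EuclideanSpace ℝ (Fin d),
          ∃ H : Finset (Finset (Fin n)),
            (∀ I ∈ H, I.card = d + 1) ∧
            lam * (n.choose (d + 1) : ℝ) ≤ (H.card : ℝ) ∧
            (⋂ I ∈ H, convexHull ℝ (x '' ↑I)).Nonempty := by
  set c : ℕ := (d + 1) ^ (3 * (d + 1)) with hc
  have hc1 : 1 < c := Nat.one_lt_pow (by omega) (by omega)
  have hc0 : (0 : ℝ) < c := by exact_mod_cast hc1.pos
  refine ⟨(c : ℝ)⁻¹, ⟨by positivity, inv_lt_one_of_one_lt₀ (by exact_mod_cast hc1)⟩,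
    fun n hn x ↦ ?_⟩
  suffices ∃ H : Finset (Finset (Fin n)), (∀ I ∈ H, I.card = d + 1) ∧
      n.choose (d + 1) ≤ c * H.card ∧ (⋂ I ∈ H, convexHull ℝ (x '' ↑I)).Nonempty by
    obtain ⟨H, h1, h2, h3⟩ := this
    exact ⟨H, h1, (inv_mul_le_iff₀ hc0).2 (by exact_mod_cast h2), h3⟩
  obtain ⟨r, hr1, hr2⟩ : ∃ r, n ≤ (d + 1) ^ 2 * r ∧ (d + 1) ^ 2 * r < n + (d + 1) ^ 2 := by
    have hD : 0 < (d + 1) ^ 2 := by positivity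
    refine ⟨n ⌈/⌉ (d + 1) ^ 2, ?_, ?_⟩
    · simpa using le_smul_ceilDiv (b := n) hD
    · rw [Nat.ceilDiv_eq_add_pred_div]
      have := Nat.mul_div_le (n + (d + 1) ^ 2 - 1) ((d + 1) ^ 2)
      omega
  rcases le_or_gt (d + 1) r with hdr | hdr
  · obtain ⟨p, hp⟩ := exists_pairwise_disjoint_mem_convexHull x
    obtain ⟨S, hS, hpS⟩ := hp r (by simpa using hr2)
    obtain ⟨H, h1, h2, h3⟩ :=
      exists_simplices_of_pairwise_disjoint finrank_euclideanSpace_fin x S p hS hpS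
    exact ⟨H, h1, h2 ▸ choose_le_pow_mul_choose d.succ_pos hdr hr1, p, Set.mem_iInter₂.2 h3⟩
  · obtain ⟨I, -, hI⟩ := Finset.exists_subset_card_eq (s := (Finset.univ : Finset (Fin n)))
      (n := d + 1) (by simpa using hn)
    refine ⟨{I}, by simpa using hI, ?_, ?_⟩
    · have hn3 : n ≤ (d + 1) ^ 3 := hr1.trans 
        (by rw [pow_succ _ 2]; exact Nat.mul_le_mul_left _ hdr.le)
      rw [Finset.card_singleton, mul_one, hc, pow_mul]
      exact (Nat.choose_le_pow n (d + 1)).trans (Nat.pow_le_pow_left hn3 _)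
    · have : I.Nonempty := Finset.card_pos.1 (by omega)
      simpa using this
end
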